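/- arXiv:math/0304149 — 6 statements merged into one kernel-verified Lean document; each statement's English description precedes it below -/
import Mathlib

section
/- Let real numbers λ_{PQ} be given for all ordered pairs of distinct symbols P,Q among {A,B,C,D,E} other than the pairs (E,D),(D,E), with λ_{QP} = -λ_{PQ}, and regard λ_{ED} = t as a real variable (with λ_{DE} = -t). Define S_{PQR} = λ_{PQ} + λ_{QR} + λ_{RP} for each ordered triple, and define the curvature function ω_{ED}(t) = α(t) + β(t) + γ(t), where α = (1/2)(S_{BDC}+S_{BEC})/(S_{BDE}S_{CDE}), β = (1/2)(S_{CDA}+S_{CEA})/(S_{CDE}S_{ADE}), γ = (1/2)(S_{ADB}+S_{AEB})/(S_{ADE}S_{BDE}) (only S_{ADE}, S_{BDE}, S_{CDE} depend on t). If at t = t₀ the three quantities S_{ADE}(t₀), S_{BDE}(t₀), S_{CDE}(t₀) are all nonzero and ω_{ED}(t₀) = 0, then S_{ABC} = S_{ADE}(t₀) · S_{BDE}(t₀) · S_{CDE}(t₀) · ω_{ED}'(t₀), where ω_{ED}' is the derivative of ω_{ED} with respect to t. -/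
/-- The derivative of a dihedral-angle term whose two denominators decrease at unit speed. -/
lemma hasDerivAt_half_mul_div_mul {f g : ℝ → ℝ} {x : ℝ} (p : ℝ)
    (hf : HasDerivAt f (-1) x) (hg : HasDerivAt g (-1) x) (hf0 : f x ≠ 0) (hg0 : g x ≠ 0) :
    HasDerivAt (fun t => (1/2) * (p / (f t * g t)))
      ((1/2) * (p * (f x + g x) / (f x * g x) ^ 2)) x := by
  refine (((hasDerivAt_const x p).div (hf.mul hg)
    (mul_ne_zero hf0 hg0)).const_mul (1/2)).congr_deriv ?_
  simp only [Pi.mul_apply]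
  ring

/- STATEMENT 0: SL(2)-solution of the pentagon equation.
Edge values λ_{PQ} are fixed antisymmetric reals for all pairs among
{A,B,C,D,E} except that λ_{ED} = t is a real variable (λ_{DE} = -t).
With S_{PQR} = λ_{PQ} + λ_{QR} + λ_{RP} and the curvature
ω_{ED}(t) = α(t) + β(t) + γ(t), if at t₀ the quantities S_{ADE}, S_{BDE},
S_{CDE} are nonzero and ω_{ED}(t₀) = 0, then
S_{ABC} = S_{ADE}(t₀) S_{BDE}(t₀) S_{CDE}(t₀) ω_{ED}'(t₀). -/
theorem pentagon_SL2_solution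
    (lAB lAC lAD lAE lBC lBD lBE lCD lCE : ℝ) (t₀ : ℝ)
    (SADE SBDE SCDE ω : ℝ → ℝ)
    -- S_{ADE}(t) = λ_{AD} + λ_{DE} + λ_{EA} = lAD + (-t) + (-lAE)
    (hSADE : ∀ t, SADE t = lAD + (-t) + (-lAE))
    -- S_{BDE}(t) = λ_{BD} + λ_{DE} + λ_{EB}
    (hSBDE : ∀ t, SBDE t = lBD + (-t) + (-lBE))
    -- S_{CDE}(t) = λ_{CD} + λ_{DE} + λ_{EC}
    (hSCDE : ∀ t, SCDE t = lCD + (-t) + (-lCE))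
    -- ω_{ED}(t) = α(t) + β(t) + γ(t), with
    -- α = (1/2)(S_{BDC}+S_{BEC})/(S_{BDE}S_{CDE}),
    -- β = (1/2)(S_{CDA}+S_{CEA})/(S_{CDE}S_{ADE}),
    -- γ = (1/2)(S_{ADB}+S_{AEB})/(S_{ADE}S_{BDE}),
    -- where S_{BDC} = λ_{BD}+λ_{DC}+λ_{CB} = lBD - lCD - lBC, etc.
    (hω : ∀ t, ω t =
      (1/2) * (((lBD + (-lCD) + (-lBC)) + (lBE + (-lCE) + (-lBC)))
        / (SBDE t * SCDE t)) +
      (1/2) * (((lCD + (-lAD) + lAC) + (lCE + (-lAE) + lAC))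
        / (SCDE t * SADE t)) +
      (1/2) * (((lAD + (-lBD) + (-lAB)) + (lAE + (-lBE) + (-lAB)))
        / (SADE t * SBDE t)))
    (hA : SADE t₀ ≠ 0) (hB : SBDE t₀ ≠ 0) (hC : SCDE t₀ ≠ 0)
    (hω0 : ω t₀ = 0) :
    -- S_{ABC} = λ_{AB} + λ_{BC} + λ_{CA}
    lAB + lBC + (-lAC) = SADE t₀ * SBDE t₀ * SCDE t₀ * deriv ω t₀ := by
  have hderiv : ∀ {f : ℝ → ℝ} {u v : ℝ}, (∀ t, f t = u + (-t) + (-v)) →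
      HasDerivAt f (-1) t₀ := by
    intro f u v hf
    rw [funext hf]
    exact ((hasDerivAt_id t₀).neg.const_add u).add_const (-v)
  have hA' := hderiv hSADE
  have hB' := hderiv hSBDE
  have hC' := hderiv hSCDE
  have hω' := ((hasDerivAt_half_mul_div_mul
      ((lBD + (-lCD) + (-lBC)) + (lBE + (-lCE) + (-lBC))) hB' hC' hB hC).add
    (hasDerivAt_half_mul_div_mul
      ((lCD + (-lAD) + lAC) + (lCE + (-lAE) + lAC)) hC' hA' hC hA)).add
    (hasDerivAt_half_mul_div_mul
      ((lAD + (-lBD) + (-lAB)) + (lAE + (-lBE) + (-lAB))) hA' hB' hA hB)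
  have hd := (hω'.congr_of_eventuallyEq (Filter.Eventually.of_forall hω)).deriv
  rw [hω] at hω0
  rw [hd]
  generalize SADE t₀ = a at *
  generalize SBDE t₀ = b at *
  generalize SCDE t₀ = c at *
  -- Clearing denominators in `ω t₀ = 0` cancels all but the constant part of `a * b * c * ω'`.
  refine Eq.trans ?_ (sub_eq_self.mpr (mul_eq_zero_of_right (b * c + c * a + a * b) hω0))
  field_simp
  ring
end

section
/- Let real numbers λ_{PQ} with λ_{QP} = -λ_{PQ} be given for all ordered pairs of distinct symbols among {A,B,C,D,E}, and set S_{PQR} = λ_{PQ} + λ_{QR} + λ_{RP}. Assume S_{ADE} ≠ 0, S_{BDE} ≠ 0, S_{CDE} ≠ 0. Then the curvature ω_{ED} = (1/2)(S_{BDC}+S_{BEC})/(S_{BDE}S_{CDE}) + (1/2)(S_{CDA}+S_{CEA})/(S_{CDE}S_{ADE}) + (1/2)(S_{ADB}+S_{AEB})/(S_{ADE}S_{BDE}) equals zero if and only if the bilinear relation S_{ADB} S_{CDE} + S_{BDC} S_{ADE} + S_{CDA} S_{BDE} = 0 holds. -/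
/- STATEMENT 1: the curvature ω_{ED} vanishes iff the bilinear relation
S_{ADB} S_{CDE} + S_{BDC} S_{ADE} + S_{CDA} S_{BDE} = 0 holds.
The λ's are antisymmetric reals on ordered pairs of the five symbols
A,B,C,D,E (indexed by Fin 5 as A=0, B=1, C=2, D=3, E=4), and
S_{PQR} = λ_{PQ} + λ_{QR} + λ_{RP}. -/
theorem curvature_zero_iff_bilinear
    (lam : Fin 5 → Fin 5 → ℝ)
    (hanti : ∀ P Q, lam Q P = -lam P Q)
    (S : Fin 5 → Fin 5 → Fin 5 → ℝ)
    (hS : ∀ P Q R, S P Q R = lam P Q + lam Q R + lam R P)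
    (hADE : S 0 3 4 ≠ 0) (hBDE : S 1 3 4 ≠ 0) (hCDE : S 2 3 4 ≠ 0) :
    ((1/2) * ((S 1 3 2 + S 1 4 2) / (S 1 3 4 * S 2 3 4)) +
     (1/2) * ((S 2 3 0 + S 2 4 0) / (S 2 3 4 * S 0 3 4)) +
     (1/2) * ((S 0 3 1 + S 0 4 1) / (S 0 3 4 * S 1 3 4)) = 0)
    ↔ S 0 3 1 * S 2 3 4 + S 1 3 2 * S 0 3 4 + S 2 3 0 * S 1 3 4 = 0 := by
  have hB : S 1 4 2 = S 1 3 2 - S 1 3 4 + S 2 3 4 := by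
    simp only [hS]
    linarith [hanti 1 4, hanti 2 3, hanti 2 4]
  have hC : S 2 4 0 = S 2 3 0 - S 2 3 4 + S 0 3 4 := by
    simp only [hS]
    linarith [hanti 2 4, hanti 0 3, hanti 0 4]
  have hA : S 0 4 1 = S 0 3 1 - S 0 3 4 + S 1 3 4 := by
    simp only [hS]
    linarith [hanti 0 4, hanti 1 3, hanti 1 4]
  have key : (1/2) * ((S 1 3 2 + S 1 4 2) / (S 1 3 4 * S 2 3 4)) +
      (1/2) * ((S 2 3 0 + S 2 4 0) / (S 2 3 4 * S 0 3 4)) +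
      (1/2) * ((S 0 3 1 + S 0 4 1) / (S 0 3 4 * S 1 3 4)) =
      (S 0 3 1 * S 2 3 4 + S 1 3 2 * S 0 3 4 + S 2 3 0 * S 1 3 4) /
        (S 0 3 4 * S 1 3 4 * S 2 3 4) := by
    rw [hA, hB, hC]
    field_simp
    ring
  rw [key, div_eq_zero_iff, or_iff_left (mul_ne_zero (mul_ne_zero hADE hBDE) hCDE)]
end

section
/- Let real numbers λ_{PQ} with λ_{QP} = -λ_{PQ} be given for all ordered pairs of distinct symbols among {A,B,C,D,E}, set S_{PQR} = λ_{PQ} + λ_{QR} + λ_{RP}, and let P(A,B,C,D,E) denote the expression S_{ADB} S_{CDE} + S_{BDC} S_{ADE} + S_{CDA} S_{BDE}. Then for every permutation σ of the five symbols, P(A,B,C,D,E) = 0 if and only if P(σ(A),σ(B),σ(C),σ(D),σ(E)) = 0; that is, the vanishing of the bilinear relation is invariant under all permutations of the five letters. -/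
/-- The bilinear relation of an antisymmetrized edge function changes sign under every transposition
of the letters. -/
theorem bilinear_swap_eq_neg (m : Fin 5 → Fin 5 → ℝ) (lam : Fin 5 → Fin 5 → ℝ)
    (hlam : ∀ P Q, lam P Q = m P Q - m Q P)
    (S : Fin 5 → Fin 5 → Fin 5 → ℝ)
    (hS : ∀ P Q R, S P Q R = lam P Q + lam Q R + lam R P)
    (P : Fin 5 → Fin 5 → Fin 5 → Fin 5 → Fin 5 → ℝ)
    (hP : ∀ a b c d e, P a b c d e =
      S a d b * S c d e + S b d c * S a d e + S c d a * S b d e)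
    (v : Fin 5 → Fin 5) {x y : Fin 5} (hxy : x ≠ y) :
    P (v (Equiv.swap x y 0)) (v (Equiv.swap x y 1)) (v (Equiv.swap x y 2))
      (v (Equiv.swap x y 3)) (v (Equiv.swap x y 4)) = -P (v 0) (v 1) (v 2) (v 3) (v 4) := by
  fin_cases x <;> fin_cases y <;>
    first
    | exact absurd rfl hxy
    | simp [Equiv.swap_apply_def, hP, hS, hlam]
      ring

/- STATEMENT 2: the vanishing of the bilinear relation
P(A,B,C,D,E) = S_{ADB} S_{CDE} + S_{BDC} S_{ADE} + S_{CDA} S_{BDE}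
is invariant under all permutations of the five letters.
The five symbols A,B,C,D,E are indexed by Fin 5 as A=0, B=1, C=2, D=3, E=4;
λ is antisymmetric and S_{PQR} = λ_{PQ} + λ_{QR} + λ_{RP}. -/
theorem bilinear_relation_permutation_invariant
    (lam : Fin 5 → Fin 5 → ℝ)
    (hanti : ∀ P Q, lam Q P = -lam P Q)
    (S : Fin 5 → Fin 5 → Fin 5 → ℝ)
    (hS : ∀ P Q R, S P Q R = lam P Q + lam Q R + lam R P)
    (P : Fin 5 → Fin 5 → Fin 5 → Fin 5 → Fin 5 → ℝ)
    (hP : ∀ a b c d e, P a b c d e =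
      S a d b * S c d e + S b d c * S a d e + S c d a * S b d e)
    (σ : Equiv.Perm (Fin 5)) :
    P 0 1 2 3 4 = 0 ↔ P (σ 0) (σ 1) (σ 2) (σ 3) (σ 4) = 0 := by
  have hlam : ∀ P Q, lam P Q = lam P Q / 2 - lam Q P / 2 := fun P Q => by
    rw [hanti P Q]
    ring
  induction σ using Equiv.Perm.swap_induction_on' with
  | one => rfl
  | mul_swap f x y hxy ih =>
    simp only [Equiv.Perm.mul_apply]
    rw [bilinear_swap_eq_neg (fun P Q => lam P Q / 2) lam hlam S hS P hP f hxy, neg_eq_zero]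
    exact ih
end

section
/- Let real numbers λ_{PQ} with λ_{QP} = -λ_{PQ} be given for all ordered pairs of distinct symbols among {A,B,C,D,E}, set S_{PQR} = λ_{PQ} + λ_{QR} + λ_{RP}, and assume S_{EDA} ≠ 0, S_{EDB} ≠ 0, S_{EDC} ≠ 0. Let u, v ∈ ℝ² be arbitrary vectors and define successively b = (S_{EBA} u + S_{EDB} v)/S_{EDA}, c = (S_{ECB} u + S_{EDC} b)/S_{EDB}, and v_new = (S_{EAC} u + S_{EDA} c)/S_{EDC}. Then v_new = v + ω_{ED} S_{EDA} u, where ω_{ED} = (1/2)(S_{BDC}+S_{BEC})/(S_{BDE}S_{CDE}) + (1/2)(S_{CDA}+S_{CEA})/(S_{CDE}S_{ADE}) + (1/2)(S_{ADB}+S_{AEB})/(S_{ADE}S_{BDE}) is the curvature around the edge ED. -/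
/- STATEMENT 6: going around the edge ED via the three relations for the
tetrahedra ABED, BCED, CAED produces the shear v ↦ v + ω_{ED} S_{EDA} u.
The five symbols A,B,C,D,E are indexed by Fin 5 as A=0, B=1, C=2, D=3, E=4;
λ is antisymmetric, S_{PQR} = λ_{PQ} + λ_{QR} + λ_{RP}, and u, v ∈ ℝ². -/
theorem holonomy_around_edge
    (lam : Fin 5 → Fin 5 → ℝ)
    (hanti : ∀ P Q, lam Q P = -lam P Q)
    (S : Fin 5 → Fin 5 → Fin 5 → ℝ)
    (hS : ∀ P Q R, S P Q R = lam P Q + lam Q R + lam R P)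
    (hEDA : S 4 3 0 ≠ 0) (hEDB : S 4 3 1 ≠ 0) (hEDC : S 4 3 2 ≠ 0)
    (u v b c vnew : ℝ × ℝ)
    -- b = (S_{EBA} u + S_{EDB} v)/S_{EDA}
    (hb : b = (S 4 3 0)⁻¹ • (S 4 1 0 • u + S 4 3 1 • v))
    -- c = (S_{ECB} u + S_{EDC} b)/S_{EDB}
    (hc : c = (S 4 3 1)⁻¹ • (S 4 2 1 • u + S 4 3 2 • b))
    -- v_new = (S_{EAC} u + S_{EDA} c)/S_{EDC}
    (hvnew : vnew = (S 4 3 2)⁻¹ • (S 4 0 2 • u + S 4 3 0 • c))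
    (ω : ℝ)
    -- ω_{ED} = (1/2)(S_{BDC}+S_{BEC})/(S_{BDE}S_{CDE})
    --        + (1/2)(S_{CDA}+S_{CEA})/(S_{CDE}S_{ADE})
    --        + (1/2)(S_{ADB}+S_{AEB})/(S_{ADE}S_{BDE})
    (hω : ω = (1/2) * ((S 1 3 2 + S 1 4 2) / (S 1 3 4 * S 2 3 4)) +
              (1/2) * ((S 2 3 0 + S 2 4 0) / (S 2 3 4 * S 0 3 4)) +
              (1/2) * ((S 0 3 1 + S 0 4 1) / (S 0 3 4 * S 1 3 4))) :
    vnew = v + (ω * S 4 3 0) • u := by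
  have h_rev : ∀ P, S P 3 4 = -S 4 3 P := fun P ↦ by
    rw [hS, hS]
    linarith [hanti 4 3, hanti P 3, hanti 4 P]
  have h_rot : ∀ P Q, S 4 Q P = S P 4 Q := fun P Q ↦ by
    rw [hS, hS]
    ring
  have h_swap : ∀ P Q, S P 3 Q = S P 4 Q + S 4 3 Q - S 4 3 P := fun P Q ↦ by
    simp only [hS]
    linarith [hanti 3 P, hanti 4 P, hanti 4 Q]
  rw [h_rev 0, h_rev 1, h_rev 2, h_swap 1 2, h_swap 2 0, h_swap 0 1] at hω
  rw [h_rot 0 1] at hb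
  rw [h_rot 1 2] at hc
  rw [h_rot 2 0] at hvnew
  subst hω hvnew hc hb
  match_scalars <;> field_simp <;> ring
end

section
/- Let A, B, C, D, E be points of ℝ² and κ_A, …, κ_E real numbers, and define for every ordered pair of these points λ_{PQ} = S_{OPQ} + κ_Q - κ_P, where S_{OPQ} = (x_P y_Q - x_Q y_P)/2. For each ordered triple put S_{PQR} = λ_{PQ} + λ_{QR} + λ_{RP}. Assume S_{ADE} ≠ 0, S_{BDE} ≠ 0, S_{CDE} ≠ 0. Then the curvature around the edge ED vanishes: α + β + γ = 0, where α = (1/2)(S_{BDC}+S_{BEC})/(S_{BDE}S_{CDE}), β = (1/2)(S_{CDA}+S_{CEA})/(S_{CDE}S_{ADE}), γ = (1/2)(S_{ADB}+S_{AEB})/(S_{ADE}S_{BDE}). -/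
/- STATEMENT 10: if all edge values come from an actual placement of the
vertices A,B,C,D,E in the plane (λ_{PQ} = S_{OPQ} + κ_Q - κ_P), then the
curvature around the edge ED vanishes: α + β + γ = 0. The five points are
indexed by Fin 5 as A=0, B=1, C=2, D=3, E=4. -/
theorem curvature_vanishes_for_plane_placement
    (pt : Fin 5 → ℝ × ℝ) (κ : Fin 5 → ℝ)
    (lam : Fin 5 → Fin 5 → ℝ)
    (hlam : ∀ P Q, lam P Q =
      ((pt P).1 * (pt Q).2 - (pt Q).1 * (pt P).2) / 2 + κ Q - κ P)
    (S : Fin 5 → Fin 5 → Fin 5 → ℝ)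
    (hS : ∀ P Q R, S P Q R = lam P Q + lam Q R + lam R P)
    (hADE : S 0 3 4 ≠ 0) (hBDE : S 1 3 4 ≠ 0) (hCDE : S 2 3 4 ≠ 0) :
    (1/2) * ((S 1 3 2 + S 1 4 2) / (S 1 3 4 * S 2 3 4)) +
    (1/2) * ((S 2 3 0 + S 2 4 0) / (S 2 3 4 * S 0 3 4)) +
    (1/2) * ((S 0 3 1 + S 0 4 1) / (S 0 3 4 * S 1 3 4)) = 0 := by
  have key : S 0 3 4 * (S 1 3 2 + S 1 4 2) + S 1 3 4 * (S 2 3 0 + S 2 4 0)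
      + S 2 3 4 * (S 0 3 1 + S 0 4 1) = 0 := by
    simp only [hS, hlam]
    ring
  field_simp
  linear_combination key
end

section
/- Let V be a finite set, let x, y : V → ℝ, and let w : V × V → ℝ satisfy w(D, E) = -w(E, D) for all E, D ∈ V. For each E ∈ V define (dγ_E)₁ = Σ_{D∈V} (x_D - x_E)² w(E,D)/2, (dγ_E)₂ = Σ_{D∈V} (x_D - x_E)(y_D - y_E) w(E,D)/2, (dγ_E)₃ = Σ_{D∈V} (y_D - y_E)² w(E,D)/2. Then Σ_{E∈V} (y_E (dγ_E)₁ - x_E (dγ_E)₂) = 0, Σ_{E∈V} (y_E (dγ_E)₂ - x_E (dγ_E)₃) = 0, and Σ_{E∈V} (y_E² (dγ_E)₁ - 2 x_E y_E (dγ_E)₂ + x_E² (dγ_E)₃) = 0. -/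
/-- The double sum of an antisymmetric function over a finite type vanishes. -/
theorem sum_sum_eq_zero_of_antisymm {V : Type*} [Fintype V] (f : V → V → ℝ)
    (hf : ∀ E D : V, f D E = -f E D) : ∑ E : V, ∑ D : V, f E D = 0 := by
  have h : ∑ E : V, ∑ D : V, f E D = -∑ E : V, ∑ D : V, f E D := by
    conv_lhs => rw [Finset.sum_comm]
    simp only [← Finset.sum_neg_distrib, ← hf]
  linarith

/- STATEMENT 12: for a finite vertex set V placed in the plane, an
antisymmetric assignment w of curvature differentials, and the vectors
dγ_E = (g₁ E, g₂ E, g₃ E) produced by the mapping f₄, the components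
dβ₄, dβ₅, dβ₆ of the mapping f₅ vanish: f₅ ∘ f₄ = 0. -/
theorem dbeta456_vanish
    (V : Type*) [Fintype V]
    (x y : V → ℝ) (w : V → V → ℝ)
    (hanti : ∀ E D : V, w D E = -w E D)
    (g₁ g₂ g₃ : V → ℝ)
    (hg₁ : ∀ E : V, g₁ E = ∑ D : V, (x D - x E)^2 * w E D / 2)
    (hg₂ : ∀ E : V, g₂ E = ∑ D : V, (x D - x E) * (y D - y E) * w E D / 2)
    (hg₃ : ∀ E : V, g₃ E = ∑ D : V, (y D - y E)^2 * w E D / 2) :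
    (∑ E : V, (y E * g₁ E - x E * g₂ E)) = 0 ∧
    (∑ E : V, (y E * g₂ E - x E * g₃ E)) = 0 ∧
    (∑ E : V, ((y E)^2 * g₁ E - 2 * x E * y E * g₂ E + (x E)^2 * g₃ E)) = 0 := by
  refine ⟨?_, ?_, ?_⟩
  · rw [← sum_sum_eq_zero_of_antisymm
      (fun E D => (x D - x E) * (y E * x D - x E * y D) * w E D / 2)
      (fun E D => by rw [hanti E D]; ring)]
    refine Finset.sum_congr rfl fun E _ => ?_
    simp only [hg₁, hg₂, Finset.mul_sum, ← Finset.sum_sub_distrib]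
    exact Finset.sum_congr rfl fun D _ => by ring
  · rw [← sum_sum_eq_zero_of_antisymm
      (fun E D => (y D - y E) * (y E * x D - x E * y D) * w E D / 2)
      (fun E D => by rw [hanti E D]; ring)]
    refine Finset.sum_congr rfl fun E _ => ?_
    simp only [hg₂, hg₃, Finset.mul_sum, ← Finset.sum_sub_distrib]
    exact Finset.sum_congr rfl fun D _ => by ring
  · rw [← sum_sum_eq_zero_of_antisymm
      (fun E D => (y E * x D - x E * y D)^2 * w E D / 2)
      (fun E D => by rw [hanti E D]; ring)]
    refine Finset.sum_congr rfl fun E _ => ?_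
    simp only [hg₁, hg₂, hg₃, Finset.mul_sum, ← Finset.sum_sub_distrib, ← Finset.sum_add_distrib]
    exact Finset.sum_congr rfl fun D _ => by ring
end
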